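/- arXiv:2210.17210 — 3 statements merged into one kernel-verified Lean document; each statement's English description precedes it below -/
import Mathlib

section
/- Let G be a boundedly endo-rigid abelian group. Then G is co-Hopfian if and only if Qr(G) holds. -/
open Cardinal

/-- The `n`-power torsion subgroup `Γ_n(G) = {g : ∃ k, n ^ k • g = 0}`. -/
def Gamma (G : Type*) [AddCommGroup G] (n : ℕ) : AddSubgroup G where
  carrier := {g | ∃ k : ℕ, n ^ k • g = 0}
  zero_mem' := ⟨0, smul_zero _⟩
  add_mem' := by
    intro a b ha hb
    obtain ⟨k, hk⟩ := ha
    obtain ⟨l, hl⟩ := hb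
    refine ⟨k + l, ?_⟩
    have ha' : n ^ (k + l) • a = 0 := by rw [pow_add, mul_comm, mul_smul, hk, smul_zero]
    have hb' : n ^ (k + l) • b = 0 := by rw [pow_add, mul_smul, hl, smul_zero]
    rw [smul_add, ha', hb', add_zero]
  neg_mem' := by
    intro a ha
    obtain ⟨k, hk⟩ := ha
    exact ⟨k, by rw [smul_neg, hk, neg_zero]⟩

/-- The torsion subgroup `tor(G)` of `G`. -/
def torsionSub (G : Type*) [AddCommGroup G] : AddSubgroup G where
  carrier := {g | ∃ k : ℕ, 0 < k ∧ k • g = 0}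
  zero_mem' := ⟨1, one_pos, smul_zero _⟩
  add_mem' := by
    intro a b ha hb
    obtain ⟨k, hk, hka⟩ := ha
    obtain ⟨l, hl, hlb⟩ := hb
    refine ⟨k * l, Nat.mul_pos hk hl, ?_⟩
    have ha' : (k * l) • a = 0 := by rw [mul_comm, mul_smul, hka, smul_zero]
    have hb' : (k * l) • b = 0 := by rw [mul_smul, hlb, smul_zero]
    rw [smul_add, ha', hb', add_zero]
  neg_mem' := by
    intro a ha
    obtain ⟨k, hk, hka⟩ := ha
    exact ⟨k, hk, by rw [smul_neg, hka, neg_zero]⟩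

/-- A homomorphism of abelian groups is bounded when its range is a bounded group. -/
def HasBoundedRange {G H : Type*} [AddCommGroup G] [AddCommGroup H] (f : G →+ H) : Prop :=
  ∃ n : ℕ, 1 ≤ n ∧ ∀ x, n • f x = 0

/-- `G` is boundedly endo-rigid: every endomorphism is `m • id` plus a bounded map. -/
def BoundedlyEndoRigid (G : Type*) [AddCommGroup G] : Prop :=
  ∀ f : G →+ G, ∃ m : ℤ, ∃ n : ℕ, 1 ≤ n ∧ ∀ x : G, n • (f x - m • x) = 0

/-- `G` is co-Hopfian: every injective endomorphism is surjective. -/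
def CoHopfian (G : Type*) [AddCommGroup G] : Prop :=
  ∀ f : G →+ G, Function.Injective f → Function.Surjective f

/-- A subgroup is bounded if some `n ≥ 1` kills all its elements. -/
def IsBoundedSubgroup {G : Type*} [AddCommGroup G] (A : AddSubgroup G) : Prop :=
  ∃ n : ℕ, 1 ≤ n ∧ ∀ x ∈ A, n • x = 0

/-- A subgroup is divisible if each of its elements is divisible, within the
subgroup, by every `n ≥ 1`. -/
def DivisibleSubgroup {G : Type*} [AddCommGroup G] (A : AddSubgroup G) : Prop :=
  ∀ n : ℕ, 0 < n → ∀ a ∈ A, ∃ b ∈ A, n • b = a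

/-- A group is reduced if its only divisible subgroup is `0`. -/
def Reduced (G : Type*) [AddCommGroup G] : Prop :=
  ∀ A : AddSubgroup G, DivisibleSubgroup A → A = ⊥

/-- A subgroup `A ≤ G` is pure if `nG ∩ A = nA` for all integers `n`. -/
def IsPureSubgroup {G : Type*} [AddCommGroup G] (A : AddSubgroup G) : Prop :=
  ∀ n : ℤ, ∀ a ∈ A, (∃ g : G, n • g = a) → ∃ b ∈ A, n • b = a

/-- The restriction of an endomorphism of `G` mapping `Γ_n(G)` into itself. -/
def restrictGamma {G : Type*} [AddCommGroup G] (n : ℕ) (h : G →+ G)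
    (hmem : ∀ x ∈ Gamma G n, h x ∈ Gamma G n) : Gamma G n →+ Gamma G n where
  toFun x := ⟨h x.1, hmem x.1 x.2⟩
  map_zero' := Subtype.ext (by simp)
  map_add' x y := Subtype.ext (by simp)

/-- An `(m, n)`-anti-witness for `G` (for `m ∣ n`): a bounded endomorphism `h` of
`Γ_n(G)` such that `h' = m • id + h` is injective, and either `h'` is not surjective, or
`m > 1` and `G/Γ_n(G)` is not `m`-divisible. -/
def IsAntiWitness (G : Type*) [AddCommGroup G] (m n : ℕ) (h : Gamma G n →+ Gamma G n) : Prop :=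
  (∃ k : ℕ, 1 ≤ k ∧ ∀ x, k • h x = 0) ∧
  Function.Injective (fun x : Gamma G n => m • x + h x) ∧
  (¬ Function.Surjective (fun x : Gamma G n => m • x + h x) ∨
    (1 < m ∧ ¬ (∀ y : G ⧸ Gamma G n, ∃ z, m • z = y)))

/-- `NQr_{(m,n)}(G)`: there exists an `(m,n)`-anti-witness. -/
def NQrAt (G : Type*) [AddCommGroup G] (m n : ℕ) : Prop :=
  ∃ h : Gamma G n →+ Gamma G n, IsAntiWitness G m n h

/-- `NQr(G)`: `NQr_{(m,n)}(G)` for some `m, n ≥ 1` with `m ∣ n`. -/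
def NQr (G : Type*) [AddCommGroup G] : Prop :=
  ∃ m n : ℕ, 1 ≤ m ∧ 1 ≤ n ∧ m ∣ n ∧ NQrAt G m n

/-- `Qr(G)`: the negation of `NQr(G)`. -/
def Qr (G : Type*) [AddCommGroup G] : Prop := ¬ NQr G

/-- `Qr_*(G)`: `Qr(G)` holds and `Γ_p(G)` is unbounded for at least one prime `p`. -/
def QrStar (G : Type*) [AddCommGroup G] : Prop :=
  Qr G ∧ ∃ p : ℕ, p.Prime ∧ ¬ IsBoundedSubgroup (Gamma G p)

/-- `S_G`: the set of primes `p` such that `G/Γ_p(G)` is not `p`-divisible. -/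
def SGset (G : Type*) [AddCommGroup G] : Set ℕ :=
  {p | p.Prime ∧ ¬ (∀ y : G ⧸ Gamma G p, ∃ z : G ⧸ Gamma G p, p • z = y)}

section Extension

variable {G M : Type*} [AddCommGroup G] [AddCommGroup M]

/-- A homomorphism on the kernel `A` of a surjection from `G` to an `𝔽_p`-vector space extends to
`G` as soon as it sends `pG` into `pM`. -/
theorem exists_extension_of_zmod_module {V : Type*} [AddCommGroup V] {p : ℕ} [Fact p.Prime]
    [Module (ZMod p) V] (π : G →+ V) (hπ : Function.Surjective π) (A : AddSubgroup G)
    (hA : ∀ {x : G}, π x = 0 ↔ x ∈ A) (hpA : ∀ x : G, p • x ∈ A) (h : A →+ M)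
    (hM : ∀ x : G, ∃ y : M, h ⟨p • x, hpA x⟩ = p • y) :
    ∃ f : G →+ M, ∀ a : A, f a = h a := by
  classical
  let b := Module.Basis.ofVectorSpace (ZMod p) V
  choose x hx using fun i => hπ (b i)
  choose y hy using fun i => hM (x i)
  let φ₀ : (Module.Basis.ofVectorSpaceIndex (ZMod p) V →₀ ℤ) →+ G :=
    (Finsupp.linearCombination ℤ x).toAddMonoidHom
  let ψ₀ : (Module.Basis.ofVectorSpaceIndex (ZMod p) V →₀ ℤ) →+ M :=
    (Finsupp.linearCombination ℤ y).toAddMonoidHom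
  have hφ₀ : ∀ c, φ₀ c = c.sum fun i a => a • x i := fun c => Finsupp.linearCombination_apply ℤ c
  have hmk : ∀ c, π (φ₀ c) = c.sum fun i a => (a : ZMod p) • b i := by
    intro c
    rw [hφ₀, Finsupp.sum, map_sum, Finsupp.sum]
    refine Finset.sum_congr rfl fun i _ => ?_
    rw [map_zsmul, hx, Int.cast_smul_eq_zsmul]
  let φ := φ₀.coprod A.subtype
  let ψ := ψ₀.coprod h
  have hsurj : Function.Surjective φ := by
    intro g
    let v := b.repr (π g)
    let c := v.mapRange (fun a : ZMod p => (a.cast : ℤ)) ZMod.cast_zero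
    have hc : π (φ₀ c) = π g := by
      rw [hmk, Finsupp.sum_mapRange_index (by simp)]
      simp only [ZMod.intCast_zmod_cast]
      exact b.linearCombination_repr _
    have hm : -φ₀ c + g ∈ A := hA.1 (by rw [map_add, map_neg, hc, neg_add_cancel])
    exact ⟨(c, ⟨_, hm⟩), by simp [φ]⟩
  have hpψ : ∀ d, h ⟨p • φ₀ d, hpA _⟩ = p • ψ₀ d := by
    let θ : G →+ A := (nsmulAddMonoidHom p).codRestrict A hpA
    suffices (h.comp (θ.comp φ₀)) = (nsmulAddMonoidHom p).comp ψ₀ from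
      fun d => DFunLike.congr_fun this d
    refine Finsupp.addHom_ext' fun i => AddMonoidHom.ext_int ?_
    have : h (θ (x i)) = p • y i := hy i
    simpa [φ₀, ψ₀] using this
  have hker : φ.ker ≤ ψ.ker := by
    rintro ⟨c, a⟩ hca
    have hca' : φ₀ c + a = 0 := hca
    have h0 : π (φ₀ c) = 0 := by
      rw [eq_neg_of_add_eq_zero_left hca']
      exact hA.2 (neg_mem a.2)
    have hdvd : ∀ i, (p : ℤ) ∣ c i := by
      intro i
      have hlin := hmk c
      rw [h0] at hlin
      have hz : c.mapRange (fun a : ℤ => (a : ZMod p)) Int.cast_zero = 0 := by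
        refine linearIndependent_iff.1 b.linearIndependent _ ?_
        rw [Finsupp.linearCombination_apply, Finsupp.sum_mapRange_index (by simp)]
        exact hlin.symm
      have := DFunLike.congr_fun hz i
      exact (ZMod.intCast_zmod_eq_zero_iff_dvd _ _).1 (by simpa using this)
    let d := c.mapRange (fun a : ℤ => a / p) (by simp)
    have hd : c = p • d := by
      ext i
      simpa [d] using (Int.mul_ediv_cancel' (hdvd i)).symm
    have ha : a = -⟨p • φ₀ d, hpA _⟩ := by
      ext
      simpa [hd] using eq_neg_of_add_eq_zero_right hca'
    change ψ₀ c + h a = 0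
    rw [ha, map_neg, hpψ, hd, map_nsmul, add_neg_cancel]
  refine ⟨φ.liftOfSurjective hsurj ⟨ψ, hker⟩, fun a => ?_⟩
  have h1 := AddMonoidHom.liftOfRightInverse_comp_apply φ _ (Function.rightInverse_surjInv hsurj)
    ⟨ψ, hker⟩ (0, a)
  simpa [φ, ψ] using h1

/-- A homomorphism on a subgroup `A ⊇ pG` extends to `G` as soon as it sends `pG` into `pM`. -/
theorem exists_extension_of_prime {p : ℕ} (hp : p.Prime) (A : AddSubgroup G)
    (hA : ∀ x : G, p • x ∈ A) (h : A →+ M) (hM : ∀ x : G, ∃ y : M, h ⟨p • x, hA x⟩ = p • y) :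
    ∃ f : G →+ M, ∀ a : A, f a = h a := by
  have : Fact p.Prime := ⟨hp⟩
  have hV : ∀ v : G ⧸ A, p • v = 0 := by
    intro v
    obtain ⟨x, rfl⟩ := QuotientAddGroup.mk'_surjective A v
    rw [← map_nsmul]
    exact (QuotientAddGroup.eq_zero_iff _).2 (hA x)
  let : Module (ZMod p) (G ⧸ A) := AddCommGroup.zmodModule hV
  exact exists_extension_of_zmod_module (QuotientAddGroup.mk' A) (QuotientAddGroup.mk'_surjective A)
    A (QuotientAddGroup.eq_zero_iff _) hA h hM

end Extension

/-- Bounded groups are pure-injective: a homomorphism from a pure subgroup to a bounded group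
extends to the whole group. -/
theorem exists_extension_of_pure.{u, v} {k : ℕ} (hk : k ≠ 0) : ∀ {G : Type u} {M : Type v}
    [AddCommGroup G] [AddCommGroup M] (T : AddSubgroup G)
    (_ : ∀ (s : ℕ) (g : G), s • g ∈ T → ∃ t ∈ T, s • t = s • g)
    (_ : ∀ y : M, k • y = 0) (h : T →+ M), ∃ f : G →+ M, ∀ t : T, f t = h t := by
  induction k using induction_on_primes with
  | zero => exact absurd rfl hk
  | one =>
    intro G M _ _ T _ hM h
    exact ⟨0, fun t => by simpa using (hM (h t)).symm⟩
  | prime_mul p k hp ih =>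
    intro G M _ _ T hT hM h
    let P : AddSubgroup G := (nsmulAddMonoidHom p : G →+ G).range
    let Q : AddSubgroup M := (nsmulAddMonoidHom p : M →+ M).range
    have hPT : ∀ z : P, (z : G) ∈ T → ∃ t : T, p • (t : G) = z := by
      rintro ⟨_, g, rfl⟩ hz
      obtain ⟨t, ht, e⟩ := hT p g hz
      exact ⟨⟨t, ht⟩, e⟩
    let T' : AddSubgroup P := T.comap P.subtype
    let h' : T' →+ Q := (h.comp ((P.subtype.comp T'.subtype).codRestrict T fun z => z.2)).codRestrict
      Q (by
        intro z
        obtain ⟨t, ht⟩ := hPT z.1 z.2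
        refine ⟨h t, ?_⟩
        change p • h t = h ⟨z.1.1, z.2⟩
        rw [← map_nsmul]
        exact congrArg h (Subtype.ext ht))
    have hk' : k ≠ 0 := by rintro rfl; simp at hk
    obtain ⟨g, hg⟩ := ih hk' (G := P) (M := Q) T' (by
        rintro s ⟨_, x, rfl⟩ hs
        have hs' : (s * p) • x ∈ T := by rw [mul_smul]; exact hs
        obtain ⟨t, ht, e⟩ := hT _ _ hs'
        refine ⟨⟨p • t, t, rfl⟩, T.nsmul_mem ht p, Subtype.ext ?_⟩
        simpa [mul_smul] using e) (by
        rintro ⟨_, y, rfl⟩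
        refine Subtype.ext ?_
        simpa [mul_smul, smul_comm k p] using hM y) h'
    have hg' : ∀ (t : T) (z : P), (z : G) = t → (g z : M) = h t := by
      rintro ⟨t, ht⟩ z rfl
      exact congrArg Subtype.val (hg ⟨z, ht⟩)
    let φ : T × P →+ G := T.subtype.coprod P.subtype
    let ψ : T × P →+ M := h.coprod (Q.subtype.comp g)
    have hker : φ.rangeRestrict.ker ≤ ψ.ker := by
      rintro ⟨t, z⟩ htz
      have e : (t : G) + z = 0 := congrArg Subtype.val htz
      change h t + g z = 0
      rw [hg' (-t) z (by simpa using eq_neg_of_add_eq_zero_right e), map_neg, add_neg_cancel]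
    let h₀ := φ.rangeRestrict.liftOfSurjective φ.rangeRestrict_surjective ⟨ψ, hker⟩
    have hh₀ : ∀ w, h₀ (φ.rangeRestrict w) = ψ w := fun w =>
      AddMonoidHom.liftOfRightInverse_comp_apply _ _
        (Function.rightInverse_surjInv φ.rangeRestrict_surjective) ⟨ψ, hker⟩ w
    have hP : ∀ x : G, φ (0, ⟨p • x, x, rfl⟩) = p • x := fun x => by simp [φ]
    obtain ⟨f, hf⟩ := exists_extension_of_prime hp φ.range (fun x => ⟨_, hP x⟩) h₀ (by
      intro x
      obtain ⟨y, hy⟩ := (g ⟨p • x, x, rfl⟩).2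
      refine ⟨y, ?_⟩
      have e := hh₀ (0, ⟨p • x, x, rfl⟩)
      rw [show φ.rangeRestrict (0, ⟨p • x, x, rfl⟩) = ⟨p • x, ⟨_, hP x⟩⟩ from
        Subtype.ext (hP x)] at e
      rw [e]
      simpa [ψ] using hy.symm)
    refine ⟨f, fun t => ?_⟩
    have e := hf (φ.rangeRestrict (t, 0))
    rw [hh₀] at e
    simpa [φ, ψ] using e

section Gamma

variable {G : Type*} [AddCommGroup G]

theorem mem_Gamma_of_smul_mem {m n : ℕ} (hmn : m ∣ n) {x : G} (hx : m • x ∈ Gamma G n) :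
    x ∈ Gamma G n := by
  obtain ⟨k, hk⟩ := hx
  obtain ⟨c, rfl⟩ := hmn
  refine ⟨k + 1, ?_⟩
  rw [pow_succ, ← mul_assoc, mul_right_comm, mul_comm _ c, mul_smul, mul_smul, hk, smul_zero]

theorem mem_Gamma_of_smul_eq_zero {m n : ℕ} (hmn : m ∣ n) {x : G} (hx : m • x = 0) :
    x ∈ Gamma G n :=
  mem_Gamma_of_smul_mem hmn (hx ▸ zero_mem _)

theorem Gamma_pure (n s : ℕ) :
    ∀ g : G, s • g ∈ Gamma G n → ∃ t ∈ Gamma G n, s • t = s • g := by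
  induction s using induction_on_primes with
  | zero => exact fun g _ => ⟨0, zero_mem _, by simp⟩
  | one => exact fun g hg => ⟨g, by simpa using hg, rfl⟩
  | prime_mul p s hp ih =>
    intro g hg
    by_cases hpn : p ∣ n
    · rw [mul_smul] at hg
      obtain ⟨t, ht, e⟩ := ih g (mem_Gamma_of_smul_mem hpn hg)
      exact ⟨t, ht, by rw [mul_smul, mul_smul, e]⟩
    · rw [mul_comm, mul_smul] at hg
      obtain ⟨t, ht, e⟩ := ih (p • g) hg
      obtain ⟨K, hK⟩ := ht
      have hcop : IsCoprime (p : ℤ) ((n ^ K : ℕ) : ℤ) :=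
        Nat.isCoprime_iff_coprime.2 (((Nat.Prime.coprime_iff_not_dvd hp).2 hpn).pow_right K)
      obtain ⟨u, v, huv⟩ := hcop
      refine ⟨u • t, zsmul_mem (show t ∈ Gamma G n from ⟨K, hK⟩) u, ?_⟩
      have ht : (u * p) • t = t := by
        have := congrArg (· • t) huv
        simpa only [add_smul, mul_smul, natCast_zsmul, hK, smul_zero, add_zero, one_smul]
          using this
      calc (p * s) • u • t = s • ((u * p) • t) := by
            rw [mul_comm p s, mul_smul, mul_smul, natCast_zsmul, smul_comm p u]
        _ = (p * s) • g := by rw [ht, e, mul_comm p s, mul_smul]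

theorem exists_extension_of_bounded {n k : ℕ} (hk : 1 ≤ k) (h : Gamma G n →+ Gamma G n)
    (hkh : ∀ x, k • h x = 0) : ∃ H : G →+ Gamma G n, ∀ x : Gamma G n, H x = h x := by
  obtain ⟨f, hf⟩ := exists_extension_of_pure (k := k) (by omega) (Gamma G n) (Gamma_pure n)
    (M := h.range) (by rintro ⟨_, x, rfl⟩; exact Subtype.ext (hkh x)) h.rangeRestrict
  exact ⟨h.range.subtype.comp f, fun x => congrArg Subtype.val (hf x)⟩

theorem CoHopfian.qr (hG : CoHopfian G) : Qr G := by
  rintro ⟨m, n, -, -, hmn, h, ⟨k, hk, hkh⟩, hinj, hbad⟩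
  obtain ⟨H, hH⟩ := exists_extension_of_bounded hk h hkh
  let f : G →+ G := nsmulAddMonoidHom m + (Gamma G n).subtype.comp H
  have hf : ∀ x, f x = m • x + H x := fun _ => rfl
  have hmem : ∀ x, f x ∈ Gamma G n → x ∈ Gamma G n := fun x hx =>
    mem_Gamma_of_smul_mem hmn (by simpa [hf] using sub_mem hx (H x).2)
  have hres : ∀ x : Gamma G n, f x = ((m • x + h x : Gamma G n) : G) := fun x => by
    simp [hf, hH]
  have hsurj : Function.Surjective f := by
    refine hG f ((injective_iff_map_eq_zero f).2 fun x hx => ?_)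
    have hxm := hmem x (hx ▸ zero_mem _)
    have h0 : m • (⟨x, hxm⟩ : Gamma G n) + h ⟨x, hxm⟩ = m • 0 + h 0 := by
      rw [map_zero, smul_zero, add_zero]
      exact Subtype.ext ((hres ⟨x, hxm⟩).symm.trans hx)
    exact congrArg Subtype.val (hinj h0)
  rcases hbad with hns | ⟨-, hnd⟩
  · refine hns fun y => ?_
    obtain ⟨x, hx⟩ := hsurj y
    have hxm := hmem x (hx ▸ y.2)
    exact ⟨⟨x, hxm⟩, Subtype.ext ((hres ⟨x, hxm⟩).symm.trans hx)⟩
  · refine hnd fun y => ?_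
    obtain ⟨y, rfl⟩ := QuotientAddGroup.mk'_surjective _ y
    obtain ⟨x, rfl⟩ := hsurj y
    refine ⟨QuotientAddGroup.mk' _ x, ?_⟩
    rw [hf, map_add, map_nsmul, left_eq_add]
    exact (QuotientAddGroup.eq_zero_iff _).2 (H x).2

theorem NQr.of_bounded_sub_smul {f : G →+ G} (hinj : Function.Injective f)
    (hsurj : ¬ Function.Surjective f) {m N : ℕ} (hm : 1 ≤ m) (hN : 1 ≤ N)
    (hf : ∀ x, N • (f x - m • x) = 0) : NQr G := by
  let h : G →+ G := f - nsmulAddMonoidHom m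
  have hh : ∀ x, f x = m • x + h x := fun x => by simp [h]
  have hhmem : ∀ x, h x ∈ Gamma G (m * N) := fun x =>
    mem_Gamma_of_smul_eq_zero (Dvd.intro_left m rfl) (hf x)
  refine ⟨m, m * N, hm, Nat.mul_pos hm hN, Dvd.intro N rfl,
    restrictGamma _ h fun x _ => hhmem x, ⟨N, hN, fun x => Subtype.ext (hf x)⟩, ?_, ?_⟩
  · intro x y hxy
    refine Subtype.ext (hinj ?_)
    rw [hh, hh]
    exact congrArg Subtype.val hxy
  · by_contra! hcon
    obtain ⟨hs, hd⟩ := hcon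
    have hd' : ∀ y : G ⧸ Gamma G (m * N), ∃ z, m • z = y := by
      rcases hm.eq_or_lt with rfl | hm
      · exact fun y => ⟨y, one_smul _ y⟩
      · exact hd hm
    refine hsurj fun y => ?_
    obtain ⟨z, hz⟩ := hd' (QuotientAddGroup.mk' _ y)
    obtain ⟨z, rfl⟩ := QuotientAddGroup.mk'_surjective _ z
    rw [← map_nsmul] at hz
    have hmem : -(m • z) + y ∈ Gamma G (m * N) := QuotientAddGroup.eq.1 hz
    obtain ⟨t, ht⟩ := hs ⟨_, sub_mem hmem (hhmem z)⟩
    refine ⟨z + t, ?_⟩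
    have ht' : f t = -(m • z) + y - h z := (hh t).trans (congrArg Subtype.val ht)
    rw [map_add, ht', hh z]
    abel

theorem Qr.coHopfian (hber : BoundedlyEndoRigid G) (hQ : Qr G) : CoHopfian G := by
  intro f hinj
  by_contra hsurj
  obtain ⟨m, N, hN, hf⟩ := hber f
  rcases lt_trichotomy m 0 with hm | rfl | hm
  · obtain ⟨k, rfl⟩ := Int.exists_eq_neg_ofNat hm.le
    refine hQ (NQr.of_bounded_sub_smul (f := -f) (m := k) (neg_injective.comp hinj)
      (fun hs => hsurj fun y => ?_) (by omega) hN fun x => ?_)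
    · obtain ⟨x, hx⟩ := hs (-y)
      exact ⟨x, neg_injective hx⟩
    · have e : (-f) x - k • x = -(f x - (-(k : ℤ)) • x) := by
        rw [neg_smul, natCast_zsmul, AddMonoidHom.neg_apply]; abel
      rw [e, smul_neg, hf, neg_zero]
  · have hG : ∀ x : G, N • x = 0 := fun x =>
      hinj (by simpa using hf x)
    exact hQ (NQr.of_bounded_sub_smul hinj hsurj le_rfl hN fun x => hG _)
  · obtain ⟨k, rfl⟩ := Int.eq_ofNat_of_zero_le hm.le
    exact hQ (NQr.of_bounded_sub_smul hinj hsurj (m := k) (by omega) hN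
      fun x => by simpa using hf x)

end Gamma

/-- a boundedly endo-rigid abelian group is co-Hopfian iff Qr(G) holds. -/
theorem stmt9 (G : Type*) [AddCommGroup G] (hber : BoundedlyEndoRigid G) :
    CoHopfian G ↔ Qr G := by
  exact ⟨CoHopfian.qr, Qr.coHopfian hber⟩
end

section
/- Let G be an abelian group that is an internal direct sum G = G₁ ⊕ G₂ of subgroups G₁ and G₂. If G is boundedly endo-rigid, then G₁ is boundedly endo-rigid. -/
open Cardinal

/-- a direct summand of a boundedly endo-rigid abelian group is boundedly
endo-rigid. -/
theorem stmt14 (G : Type*) [AddCommGroup G] (G₁ G₂ : AddSubgroup G)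
    (hcompl : IsCompl G₁ G₂) (hber : BoundedlyEndoRigid G) :
    BoundedlyEndoRigid G₁ := by
  intro f
  have h := AddSubgroup.toIntSubmodule.isCompl hcompl
  let π : G →+ G₁ := (Submodule.projectionOnto _ _ h).toAddMonoidHom
  have hπ (x : G₁) : π x = x := Submodule.projectionOnto_apply_left h x
  obtain ⟨m, n, hn, hm⟩ := hber ((G₁.subtype.comp f).comp π)
  refine ⟨m, n, hn, fun x => Subtype.ext ?_⟩
  simpa [hπ] using hm x
end

section
/- Every boundedly endo-rigid abelian group is reduced; that is, a boundedly endo-rigid abelian group contains no divisible subgroup other than 0. -/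
open Cardinal

/-- In a boundedly endo-rigid group, if multiplication by `q` is injective on a subgroup `B` of a
divisible subgroup, then some integer inverts `q` on `B`. -/
theorem BoundedlyEndoRigid.exists_smul_smul_eq {G : Type*} [AddCommGroup G]
    (hG : BoundedlyEndoRigid G) {A B : AddSubgroup G} (hA : DivisibleSubgroup A) (hBA : B ≤ A)
    (q : ℕ) (hq : ∀ b ∈ B, q • b = 0 → b = 0) : ∃ m : ℤ, ∀ b ∈ B, m • q • b = b := by
  have hsurj : ∀ {n : ℕ}, n ≠ 0 → Function.Surjective (fun a : A => n • a) := by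
    intro n hn a
    obtain ⟨b, hb, hab⟩ := hA n (Nat.pos_of_ne_zero hn) a a.2
    exact ⟨⟨b, hb⟩, Subtype.ext hab⟩
  let _ : DivisibleBy A ℕ := divisibleByOfSMulRightSurj A ℕ hsurj
  let _ : DivisibleBy A ℤ := AddGroup.divisibleByIntOfDivisibleByNat A
  have hinj : Function.Injective (q • B.subtype) := by
    rw [injective_iff_map_eq_zero]
    intro b hb
    exact Subtype.ext (hq b b.2 (by simpa using hb))
  obtain ⟨h, hh⟩ := (Module.Baer.of_divisible A).extension_property_addMonoidHom
    (q • B.subtype) hinj (AddSubgroup.inclusion hBA)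
  obtain ⟨m, n, hn, hm⟩ := hG (A.subtype.comp h)
  refine ⟨m, fun b hb => ?_⟩
  obtain ⟨c, -, hc⟩ := hA n hn (q • b) (A.nsmul_mem (hBA hb) q)
  have hval : (h (q • b) : G) = b := congrArg Subtype.val (DFunLike.congr_fun hh ⟨b, hb⟩)
  have hmc : n • (A.subtype.comp h) c = n • m • c := by
    rw [← sub_eq_zero, ← smul_sub]
    exact hm c
  rw [← map_nsmul, smul_comm n m c, hc] at hmc
  exact hmc.symm.trans hval

/-- every boundedly endo-rigid abelian group is reduced. -/
theorem stmt15 (G : Type*) [AddCommGroup G] (hber : BoundedlyEndoRigid G) :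
    Reduced G := by
  intro A hA
  by_cases h2 : ∀ b ∈ A, 2 • b = 0 → b = 0
  · obtain ⟨m, hm⟩ := hber.exists_smul_smul_eq hA le_rfl 2 h2
    rw [eq_bot_iff]
    intro x hx
    obtain ⟨c, hc, rfl⟩ := hA (2 * m - 1).natAbs (by omega) x hx
    rw [AddSubgroup.mem_bot, natAbs_nsmul_eq_zero, sub_smul, one_smul, sub_eq_zero]
    have := hm c hc
    rwa [← natCast_zsmul, smul_smul, mul_comm] at this
  · push Not at h2
    obtain ⟨x, hx, hx2, hx0⟩ := h2
    obtain ⟨m, hm⟩ := hber.exists_smul_smul_eq hA (B := A ⊓ Gamma G 2) inf_le_left 3 (by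
      rintro b ⟨-, k, hk⟩ h3
      have h3' := addOrderOf_dvd_of_nsmul_eq_zero h3
      have hk' := addOrderOf_dvd_of_nsmul_eq_zero hk
      have hcop : Nat.Coprime 3 (2 ^ k) := Nat.Coprime.pow_right k (by norm_num)
      exact AddMonoid.addOrderOf_eq_one_iff.mp (Nat.eq_one_of_dvd_coprimes hcop h3' hk'))
    set k := (3 * m - 1).natAbs with hkdef
    obtain ⟨c, hc, hcx⟩ := hA (2 ^ k) (by positivity) x hx
    have hc2 : 2 ^ (k + 1) • c = 0 := by rw [pow_succ', mul_smul, hcx, hx2]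
    have hord : addOrderOf c = 2 ^ (k + 1) :=
      addOrderOf_eq_prime_pow (by rwa [hcx]) hc2
    have hkc : k • c = 0 := by
      rw [hkdef, natAbs_nsmul_eq_zero, sub_smul, one_smul, sub_eq_zero]
      have := hm c ⟨hc, k + 1, hc2⟩
      rwa [← natCast_zsmul, smul_smul, mul_comm] at this
    have hle := Nat.le_of_dvd (by omega) (addOrderOf_dvd_of_nsmul_eq_zero hkc)
    rw [hord] at hle
    have := (k + 1).lt_two_pow_self
    omega
end
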